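/- There is no monic real polynomial P of degree 6 with all seven coefficients nonzero such that every real root of each of P, P', P'', P''', P'''', P''''' is simple, and such that (counting roots with multiplicity): P has exactly 0 positive and 2 negative real roots, P' has exactly 2 positive and 3 negative, P'' has exactly 1 positive and 3 negative, P''' has exactly 1 positive and 2 negative, P'''' has exactly 1 positive and 1 negative, and P''''' has exactly 1 positive and 0 negative real roots. -/

import Mathlib

open Polynomial

/-- The number of roots of `Q` in `(0, ∞)`, counted with multiplicity. -/
noncomputable def posRoots (Q : Polynomial ℝ) : ℕ :=
  (Q.roots.filter fun x => 0 < x).card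

/-- The number of roots of `Q` in `(−∞, 0)`, counted with multiplicity. -/
noncomputable def negRoots (Q : Polynomial ℝ) : ℕ :=
  (Q.roots.filter fun x => x < 0).card

/-- A primitive of `6 (x + a₁) (x + a₂) (x + a₃) (x - b₁) (x - b₂)`, with constant term `k`. -/
noncomputable def sexticPrimitive (a₁ a₂ a₃ b₁ b₂ k x : ℝ) : ℝ :=
  x ^ 6 + 6 / 5 * (a₁ + a₂ + a₃ - (b₁ + b₂)) * x ^ 5
    + 6 / 4 * (a₁ * a₂ + a₁ * a₃ + a₂ * a₃ - (b₁ + b₂) * (a₁ + a₂ + a₃) + b₁ * b₂) * x ^ 4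
    + 2 * (a₁ * a₂ * a₃ - (b₁ + b₂) * (a₁ * a₂ + a₁ * a₃ + a₂ * a₃)
        + b₁ * b₂ * (a₁ + a₂ + a₃)) * x ^ 3
    + 3 * (b₁ * b₂ * (a₁ * a₂ + a₁ * a₃ + a₂ * a₃) - (b₁ + b₂) * (a₁ * a₂ * a₃)) * x ^ 2
    + 6 * (a₁ * a₂ * a₃ * (b₁ * b₂)) * x + k

lemma hasDerivAt_sexticPrimitive (a₁ a₂ a₃ b₁ b₂ k x : ℝ) :
    HasDerivAt (sexticPrimitive a₁ a₂ a₃ b₁ b₂ k)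
      (6 * ((x + a₁) * (x + a₂) * (x + a₃) * (x - b₁) * (x - b₂))) x := by
  have h := ((((((hasDerivAt_pow 6 x).add
    ((hasDerivAt_pow 5 x).const_mul (6 / 5 * (a₁ + a₂ + a₃ - (b₁ + b₂))))).add
    ((hasDerivAt_pow 4 x).const_mul
      (6 / 4 * (a₁ * a₂ + a₁ * a₃ + a₂ * a₃ - (b₁ + b₂) * (a₁ + a₂ + a₃) + b₁ * b₂)))).add
    ((hasDerivAt_pow 3 x).const_mul
      (2 * (a₁ * a₂ * a₃ - (b₁ + b₂) * (a₁ * a₂ + a₁ * a₃ + a₂ * a₃)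
        + b₁ * b₂ * (a₁ + a₂ + a₃))))).add
    ((hasDerivAt_pow 2 x).const_mul
      (3 * (b₁ * b₂ * (a₁ * a₂ + a₁ * a₃ + a₂ * a₃) - (b₁ + b₂) * (a₁ * a₂ * a₃))))).add
    ((hasDerivAt_id x).const_mul (6 * (a₁ * a₂ * a₃ * (b₁ * b₂))))).add_const k
  refine h.congr_deriv ?_
  norm_num
  ring

section Minima

variable {a₁ a₂ a₃ b₁ b₂ : ℝ}

/-- The positive critical point `b₁` is less than half of `a₂`, and `b₂` is comparatively far. -/
lemma two_mul_add_le_of_sum_lt (ha₁ : 0 < a₁) (h₁₂ : a₁ ≤ a₂) (h₂₃ : a₂ ≤ a₃)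
    (hb₁ : 0 < b₁) (hb : b₁ ≤ b₂) (hsum : a₁ + a₂ + a₃ < b₁ + b₂)
    (hinv : b₁ * b₂ * (a₁ * a₂ + a₁ * a₃ + a₂ * a₃) < (b₁ + b₂) * (a₁ * a₂ * a₃)) :
    2 * b₁ + a₁ ≤ b₂ := by
  have ha₂ : 0 < a₂ := ha₁.trans_le h₁₂
  have ha₃ : 0 < a₃ := ha₂.trans_le h₂₃
  have hb₂ : 0 < b₂ := hb₁.trans_le hb
  have hrec : 1 / a₁ + 1 / a₂ + 1 / a₃ < 1 / b₁ + 1 / b₂ := by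
    rw [div_add_div _ _ ha₁.ne' ha₂.ne', div_add_div _ _ (by positivity) ha₃.ne',
      div_add_div _ _ hb₁.ne' hb₂.ne', div_lt_div_iff₀ (by positivity) (by positivity)]
    linarith
  have hba : a₃ < b₂ := by
    by_contra! hle
    have hlt : a₂ < b₁ := by linarith
    have h₁ : 1 / b₁ < 1 / a₂ := one_div_lt_one_div_of_lt ha₂ hlt
    have h₂ : 1 / b₂ ≤ 1 / b₁ := one_div_le_one_div_of_le hb₁ hb
    have h₃ : 1 / a₂ ≤ 1 / a₁ := one_div_le_one_div_of_le ha₁ h₁₂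
    have h₄ : 0 < 1 / a₃ := by positivity
    linarith
  have hhalf : 2 * b₁ < a₂ := by
    have h₁ : 1 / b₂ < 1 / a₃ := one_div_lt_one_div_of_lt ha₃ hba
    have h₃ : 1 / a₂ ≤ 1 / a₁ := one_div_le_one_div_of_le ha₁ h₁₂
    have h₄ : 2 / a₂ < 1 / b₁ := by
      have : 2 / a₂ = 1 / a₂ + 1 / a₂ := by ring
      linarith
    rwa [div_lt_div_iff₀ ha₂ hb₁, one_mul] at h₄
  linarith

lemma sexticPrimitive_reflect_le (k : ℝ) (ha₁ : 0 < a₁) (h₁₂ : a₁ ≤ a₂) (h₂₃ : a₂ ≤ a₃)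
    (hb₁ : 0 < b₁) (hfar : 2 * b₁ + a₁ ≤ b₂) :
    sexticPrimitive a₁ a₂ a₃ b₁ b₂ k (2 * b₁ + a₁) ≤
      sexticPrimitive a₁ a₂ a₃ b₁ b₂ k (-a₁) := by
  obtain ⟨s₁, hs₁⟩ : ∃ s, s = a₁ + b₁ := ⟨_, rfl⟩
  obtain ⟨s₂, hs₂⟩ : ∃ s, s = a₂ + b₁ := ⟨_, rfl⟩
  obtain ⟨s₃, hs₃⟩ : ∃ s, s = a₃ + b₁ := ⟨_, rfl⟩
  obtain ⟨v, hv⟩ : ∃ v, v = b₂ - b₁ - s₁ := ⟨_, rfl⟩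
  have p₁ : 0 < s₁ := by linarith
  have p₂ : 0 < s₂ := by linarith
  have p₃ : 0 < s₃ := by linarith
  have pv : 0 ≤ v := by linarith
  have key : sexticPrimitive a₁ a₂ a₃ b₁ b₂ k (-a₁) -
      sexticPrimitive a₁ a₂ a₃ b₁ b₂ k (2 * b₁ + a₁) =
      s₁ ^ 3 * (4 * v * (s₁ * s₂ + s₁ * s₃ + s₂ * s₃) + 12 / 5 * v * s₁ ^ 2
        + 8 / 5 * s₁ ^ 2 * (s₂ + s₃)) := by
    subst hv hs₁ hs₂ hs₃
    unfold sexticPrimitive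
    ring
  have : 0 ≤ s₁ ^ 3 * (4 * v * (s₁ * s₂ + s₁ * s₃ + s₂ * s₃) + 12 / 5 * v * s₁ ^ 2
        + 8 / 5 * s₁ ^ 2 * (s₂ + s₃)) := by positivity
  linarith

lemma sexticPrimitive_le_neg (k : ℝ) (ha₁ : 0 < a₁) (h₁₂ : a₁ ≤ a₂) (h₂₃ : a₂ ≤ a₃)
    (hsum : a₁ + a₂ + a₃ < b₁ + b₂)
    (hinv : b₁ * b₂ * (a₁ * a₂ + a₁ * a₃ + a₂ * a₃) < (b₁ + b₂) * (a₁ * a₂ * a₃)) :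
    sexticPrimitive a₁ a₂ a₃ b₁ b₂ k a₃ ≤ sexticPrimitive a₁ a₂ a₃ b₁ b₂ k (-a₃) := by
  have ha₂ : 0 < a₂ := ha₁.trans_le h₁₂
  have ha₃ : 0 < a₃ := ha₂.trans_le h₂₃
  have key : sexticPrimitive a₁ a₂ a₃ b₁ b₂ k a₃ - sexticPrimitive a₁ a₂ a₃ b₁ b₂ k (-a₃) =
      12 * a₃ * ((a₁ + a₂ + a₃ - (b₁ + b₂)) * a₃ ^ 4 / 5
        + (a₁ * a₂ * a₃ - (b₁ + b₂) * (a₁ * a₂ + a₁ * a₃ + a₂ * a₃)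
          + b₁ * b₂ * (a₁ + a₂ + a₃)) * a₃ ^ 2 / 3 + b₁ * b₂ * (a₁ * a₂ * a₃)) := by
    unfold sexticPrimitive
    ring
  obtain ⟨s, hs⟩ : ∃ s, s = a₁ + a₂ + a₃ := ⟨_, rfl⟩
  obtain ⟨q, hq⟩ : ∃ q, q = a₁ * a₂ + a₁ * a₃ + a₂ * a₃ := ⟨_, rfl⟩
  obtain ⟨m, hm⟩ : ∃ m, m = a₁ * a₂ * a₃ := ⟨_, rfl⟩
  have ps : 0 < s := by rw [hs]; positivity
  have pq : 0 < q := by rw [hq]; positivity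
  have pm : 0 < m := by rw [hm]; positivity
  have hqm : 3 * (s * m) ≤ q ^ 2 := by
    subst hs hq hm
    nlinarith [sq_nonneg (a₁ * a₂ - a₁ * a₃), sq_nonneg (a₁ * a₂ - a₂ * a₃),
      sq_nonneg (a₁ * a₃ - a₂ * a₃)]
  have hsq : 3 * q ≤ s ^ 2 := by
    subst hs hq
    nlinarith [sq_nonneg (a₁ - a₂), sq_nonneg (a₁ - a₃), sq_nonneg (a₂ - a₃)]
  have hmc : 3 * m ≤ s * a₃ ^ 2 := by
    have e₁ : a₁ * a₂ ≤ a₁ * a₃ := by gcongr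
    have e₂ : a₁ * a₂ ≤ a₂ * a₃ := by nlinarith
    have e₃ : a₁ * a₂ ≤ a₃ * a₃ := by nlinarith
    subst hs hm
    nlinarith
  rw [← hs, ← hq, ← hm] at key
  rw [← hq, ← hm] at hinv
  rw [← hs] at hsum
  generalize b₁ + b₂ = σ at *
  generalize b₁ * b₂ = π at *
  have hslope : m * (s * a₃ ^ 2 / 3 + m) ≤ q ^ 2 * a₃ ^ 2 / 3 := by
    nlinarith [mul_le_mul_of_nonneg_right hqm (sq_nonneg a₃), mul_le_mul_of_nonneg_left hmc pm.le,
      mul_pos (mul_pos ps pm) (pow_pos ha₃ 2)]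
  have hvertex : m * q * a₃ ^ 2 / 3 + s * (m * (s * a₃ ^ 2 / 3 + m)) ≤ s * q ^ 2 * a₃ ^ 2 / 3 := by
    have e₁ := mul_le_mul_of_nonneg_left hqm (mul_pos ps (pow_pos ha₃ 2)).le
    have e₂ := mul_le_mul_of_nonneg_left hmc (mul_pos ps pm).le
    have e₃ := mul_le_mul_of_nonneg_left hsq (mul_pos pm (pow_pos ha₃ 2)).le
    have e₄ : 0 < s ^ 2 * m * a₃ ^ 2 := by positivity
    nlinarith
  have hE : q * ((s - σ) * a₃ ^ 4 / 5 + (m - σ * q + π * s) * a₃ ^ 2 / 3 + π * m) ≤ 0 := by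
    have e₁ : (π * q) * (s * a₃ ^ 2 / 3 + m) ≤ (σ * m) * (s * a₃ ^ 2 / 3 + m) := by gcongr
    have e₂ := mul_le_mul_of_nonneg_left hslope (sub_pos.2 hsum).le
    have e₃ : 0 ≤ q * (σ - s) * a₃ ^ 4 := by
      have := sub_pos.2 hsum
      positivity
    linarith
  have hE' : (s - σ) * a₃ ^ 4 / 5 + (m - σ * q + π * s) * a₃ ^ 2 / 3 + π * m ≤ 0 :=
    nonpos_of_mul_nonpos_right hE pq
  have := mul_nonpos_of_nonneg_of_nonpos (by positivity : 0 ≤ 12 * a₃) hE'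
  linarith

lemma min_le_sexticPrimitive (k : ℝ) (ha₁ : 0 < a₁) (h₁₂ : a₁ ≤ a₂) (h₂₃ : a₂ ≤ a₃)
    (hb₁ : 0 < b₁) (hb : b₁ ≤ b₂) {x : ℝ} (hx : x ≤ 0) :
    min (sexticPrimitive a₁ a₂ a₃ b₁ b₂ k (-a₁)) (sexticPrimitive a₁ a₂ a₃ b₁ b₂ k (-a₃)) ≤
      sexticPrimitive a₁ a₂ a₃ b₁ b₂ k x := by
  set f := sexticPrimitive a₁ a₂ a₃ b₁ b₂ k
  have hf : ∀ y, HasDerivAt f (6 * ((y + a₁) * (y + a₂) * (y + a₃) * (y - b₁) * (y - b₂))) y :=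
    hasDerivAt_sexticPrimitive a₁ a₂ a₃ b₁ b₂ k
  have hcont : Continuous f := continuous_iff_continuousAt.2 fun y => (hf y).continuousAt
  have hdiff : Differentiable ℝ f := fun y => (hf y).differentiableAt
  have hquad : ∀ y ≤ 0, 0 ≤ (y - b₁) * (y - b₂) := fun y hy =>
    mul_nonneg_of_nonpos_of_nonpos (by linarith) (by linarith)
  have hmono : ∀ u v, u ≤ v → (∀ y, u < y → y < v →
      0 ≤ (y + a₁) * (y + a₂) * (y + a₃)) → v ≤ 0 → f u ≤ f v := by
    intro u v huv hsign hv
    refine monotoneOn_of_deriv_nonneg (convex_Icc u v) hcont.continuousOn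
      hdiff.differentiableOn (fun y hy => ?_) (Set.left_mem_Icc.2 huv) (Set.right_mem_Icc.2 huv) huv
    rw [interior_Icc] at hy
    rw [(hf y).deriv]
    have := mul_nonneg (hsign y hy.1 hy.2) (hquad y (hy.2.le.trans hv))
    linarith
  have hanti : ∀ u v, u ≤ v → (∀ y, u < y → y < v →
      (y + a₁) * (y + a₂) * (y + a₃) ≤ 0) → v ≤ 0 → f v ≤ f u := by
    intro u v huv hsign hv
    refine antitoneOn_of_deriv_nonpos (convex_Icc u v) hcont.continuousOn
      hdiff.differentiableOn (fun y hy => ?_) (Set.left_mem_Icc.2 huv) (Set.right_mem_Icc.2 huv) huv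
    rw [interior_Icc] at hy
    rw [(hf y).deriv]
    have := mul_nonpos_of_nonpos_of_nonneg (hsign y hy.1 hy.2) (hquad y (hy.2.le.trans hv))
    linarith
  rcases le_total x (-a₂) with h₂ | h₂
  · refine (min_le_right _ _).trans ?_
    rcases le_total x (-a₃) with h₃ | h₃
    · refine hanti _ _ h₃ (fun y _ hy => ?_) (by linarith)
      exact mul_nonpos_of_nonneg_of_nonpos
        (mul_nonneg_of_nonpos_of_nonpos (by linarith) (by linarith)) (by linarith)
    · refine hmono _ _ h₃ (fun y hy hy' => ?_) hx
      exact mul_nonneg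
        (mul_nonneg_of_nonpos_of_nonpos (by linarith) (by linarith)) (by linarith)
  · refine (min_le_left _ _).trans ?_
    rcases le_total x (-a₁) with h₁ | h₁
    · refine hanti _ _ h₁ (fun y hy hy' => ?_) (by linarith)
      exact mul_nonpos_of_nonpos_of_nonneg
        (mul_nonpos_of_nonpos_of_nonneg (by linarith) (by linarith)) (by linarith)
    · refine hmono _ _ h₁ (fun y hy hy' => ?_) hx
      exact mul_nonneg (mul_nonneg (by linarith) (by linarith)) (by linarith)

/-- If the critical points of the sextic satisfy `∑ aᵢ < ∑ bⱼ` and `∑ 1 / aᵢ < ∑ 1 / bⱼ`, then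
positivity on the positive half-line implies positivity on the negative one. -/
lemma sexticPrimitive_pos_of_neg {k : ℝ} (ha₁ : 0 < a₁) (h₁₂ : a₁ ≤ a₂) (h₂₃ : a₂ ≤ a₃)
    (hb₁ : 0 < b₁) (hb : b₁ ≤ b₂) (hsum : a₁ + a₂ + a₃ < b₁ + b₂)
    (hinv : b₁ * b₂ * (a₁ * a₂ + a₁ * a₃ + a₂ * a₃) < (b₁ + b₂) * (a₁ * a₂ * a₃))
    (hpos : ∀ x, 0 < x → 0 < sexticPrimitive a₁ a₂ a₃ b₁ b₂ k x) {x : ℝ} (hx : x < 0) :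
    0 < sexticPrimitive a₁ a₂ a₃ b₁ b₂ k x := by
  have hfar := two_mul_add_le_of_sum_lt ha₁ h₁₂ h₂₃ hb₁ hb hsum hinv
  refine lt_of_lt_of_le (lt_min ?_ ?_) (min_le_sexticPrimitive k ha₁ h₁₂ h₂₃ hb₁ hb hx.le)
  · exact (hpos _ (by linarith)).trans_le (sexticPrimitive_reflect_le k ha₁ h₁₂ h₂₃ hb₁ hfar)
  · exact (hpos _ (by linarith)).trans_le (sexticPrimitive_le_neg k ha₁ h₁₂ h₂₃ hsum hinv)

end Minima

lemma exists_pos_root_of_posRoots_ne_zero {Q : ℝ[X]} (h : posRoots Q ≠ 0) :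
    ∃ x, 0 < x ∧ Q.eval x = 0 := by
  obtain ⟨x, hx⟩ := Multiset.card_pos_iff_exists_mem.1 (Nat.pos_of_ne_zero h)
  rw [Multiset.mem_filter] at hx
  exact ⟨x, hx.2, isRoot_of_mem_roots hx.1⟩

lemma exists_neg_root_of_negRoots_ne_zero {Q : ℝ[X]} (h : negRoots Q ≠ 0) :
    ∃ x, x < 0 ∧ Q.eval x = 0 := by
  obtain ⟨x, hx⟩ := Multiset.card_pos_iff_exists_mem.1 (Nat.pos_of_ne_zero h)
  rw [Multiset.mem_filter] at hx
  exact ⟨x, hx.2, isRoot_of_mem_roots hx.1⟩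

lemma eval_ne_zero_of_posRoots_eq_zero {Q : ℝ[X]} (hQ : Q ≠ 0) (h : posRoots Q = 0) {x : ℝ}
    (hx : 0 < x) : Q.eval x ≠ 0 := by
  intro h0
  have hmem : x ∈ Q.roots.filter fun x => 0 < x :=
    Multiset.mem_filter.2 ⟨(mem_roots hQ).2 h0, hx⟩
  rw [Multiset.card_eq_zero.1 h] at hmem
  exact Multiset.notMem_zero x hmem

/-- A polynomial without positive roots and with positive leading coefficient is positive
on the positive half-line. -/
lemma eval_pos_of_posRoots_eq_zero {Q : ℝ[X]} (hQ : 0 < Q.leadingCoeff) (hdeg : 0 < Q.degree)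
    (h : posRoots Q = 0) {x : ℝ} (hx : 0 < x) : 0 < Q.eval x := by
  have hQ0 : Q ≠ 0 := leadingCoeff_ne_zero.1 hQ.ne'
  by_contra! hle
  obtain ⟨y, hy, hxy⟩ := (((Q.tendsto_atTop_of_leadingCoeff_nonneg hdeg hQ.le).eventually_gt_atTop
    0).and (Filter.eventually_ge_atTop x)).exists
  obtain ⟨z, hz, hz0⟩ := intermediate_value_Icc hxy Q.continuous.continuousOn ⟨hle, hy.le⟩
  exact eval_ne_zero_of_posRoots_eq_zero hQ0 h (hx.trans_le hz.1) hz0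

/-- When all roots are accounted for, none is zero and the polynomial splits. -/
lemma eq_prod_of_posRoots_add_negRoots {Q : ℝ[X]} (h : posRoots Q + negRoots Q = Q.natDegree) :
    Q = C Q.leadingCoeff * (((Q.roots.filter fun x => 0 < x).map fun r => X - C r).prod *
      ((Q.roots.filter fun x => x < 0).map fun r => X - C r).prod) := by
  have hle : (Q.roots.filter fun x => 0 < x) + (Q.roots.filter fun x => x < 0) ≤ Q.roots := by
    have hsplit := Multiset.filter_add_not (fun x : ℝ => 0 < x) Q.roots
    conv_rhs => rw [← hsplit]
    gcongr
    exact Multiset.monotone_filter_right _ fun x hx => not_lt.2 hx.le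
  have heq : (Q.roots.filter fun x => 0 < x) + (Q.roots.filter fun x => x < 0) = Q.roots := by
    refine Multiset.eq_of_le_of_card_le hle ?_
    rw [Multiset.card_add]
    exact (card_roots' Q).trans h.ge
  have hcard : Q.roots.card = Q.natDegree := by
    rw [← heq, Multiset.card_add]
    exact h
  rw [← Multiset.prod_add, ← Multiset.map_add, heq]
  exact (C_leadingCoeff_mul_prod_multiset_X_sub_C hcard).symm

lemma Multiset.exists_eq_pair_of_card_eq_two {s : Multiset ℝ} (h : s.card = 2) :
    ∃ x y, x ≤ y ∧ s = {x, y} := by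
  obtain ⟨x, y, rfl⟩ := Multiset.card_eq_two.1 h
  rcases le_total x y with hxy | hxy
  · exact ⟨x, y, hxy, rfl⟩
  · exact ⟨y, x, hxy, Multiset.pair_comm x y⟩

lemma Multiset.exists_eq_triple_of_card_eq_three {s : Multiset ℝ} (h : s.card = 3) :
    ∃ x y z, x ≤ y ∧ y ≤ z ∧ s = {x, y, z} := by
  have hlen : (s.sort (· ≤ ·)).length = 3 := by rw [Multiset.length_sort, h]
  obtain ⟨x, y, z, hxyz⟩ := List.length_eq_three.1 hlen
  have hsorted := s.pairwise_sort (· ≤ ·)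
  rw [hxyz] at hsorted
  refine ⟨x, y, z, ?_, ?_, ?_⟩
  · simp_all
  · simp_all
  · rw [← s.sort_eq (· ≤ ·), hxyz]
    rfl

/-- A quartic with positive leading coefficient, one positive and three negative roots is negative
at the origin. -/
lemma eval_zero_neg_of_posRoots_eq_one {Q : ℝ[X]} (hQ : 0 < Q.leadingCoeff)
    (hdeg : Q.natDegree = 4) (hpos : posRoots Q = 1) (hneg : negRoots Q = 3) :
    Q.eval 0 < 0 := by
  have hprod := eq_prod_of_posRoots_add_negRoots (Q := Q) (by omega)
  obtain ⟨b, hb⟩ := Multiset.card_eq_one.1 hpos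
  obtain ⟨x, y, z, -, -, hxyz⟩ := Multiset.exists_eq_triple_of_card_eq_three hneg
  have hb0 : 0 < b := (Multiset.mem_filter.1 (hb ▸ Multiset.mem_singleton_self b)).2
  have hmem : ∀ w ∈ ({x, y, z} : Multiset ℝ), w < 0 := fun w hw => by
    rw [← hxyz] at hw
    exact (Multiset.mem_filter.1 hw).2
  have hx : x < 0 := hmem x (by simp)
  have hy : y < 0 := hmem y (by simp)
  have hz : z < 0 := hmem z (by simp)
  rw [hb, hxyz] at hprod
  rw [hprod]
  simp only [Multiset.insert_eq_cons, Multiset.map_cons, Multiset.map_singleton,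
    Multiset.prod_cons, Multiset.prod_singleton, eval_mul, eval_sub, eval_X, eval_C, zero_sub]
  have h₁ : 0 < -x * (-y * -z) := mul_pos (neg_pos.2 hx) (mul_pos (neg_pos.2 hy) (neg_pos.2 hz))
  have h₂ := mul_pos hQ (mul_pos hb0 h₁)
  linarith

/-- A quintic with two positive and three negative roots, in terms of the absolute values of its
roots. -/
lemma exists_eq_quintic_prod {Q : ℝ[X]} (hdeg : Q.natDegree = 5) (hpos : posRoots Q = 2)
    (hneg : negRoots Q = 3) :
    ∃ a₁ a₂ a₃ b₁ b₂ : ℝ, 0 < a₁ ∧ a₁ ≤ a₂ ∧ a₂ ≤ a₃ ∧ 0 < b₁ ∧ b₁ ≤ b₂ ∧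
      Q = C Q.leadingCoeff *
        ((X + C a₁) * (X + C a₂) * (X + C a₃) * (X - C b₁) * (X - C b₂)) := by
  have hprod := eq_prod_of_posRoots_add_negRoots (Q := Q) (by omega)
  obtain ⟨b₁, b₂, hb, hbs⟩ := Multiset.exists_eq_pair_of_card_eq_two hpos
  obtain ⟨x, y, z, hxy, hyz, hxyz⟩ := Multiset.exists_eq_triple_of_card_eq_three hneg
  have hb₁ : 0 < b₁ := by
    have hmem : b₁ ∈ ({b₁, b₂} : Multiset ℝ) := by simp
    rw [← hbs] at hmem
    exact (Multiset.mem_filter.1 hmem).2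
  have hz : z < 0 := by
    have hmem : z ∈ ({x, y, z} : Multiset ℝ) := by simp
    rw [← hxyz] at hmem
    exact (Multiset.mem_filter.1 hmem).2
  refine ⟨-z, -y, -x, b₁, b₂, neg_pos.2 hz, neg_le_neg hyz, neg_le_neg hxy, hb₁, hb, ?_⟩
  rw [hbs, hxyz] at hprod
  refine hprod.trans ?_
  simp only [Multiset.insert_eq_cons, Multiset.map_cons, Multiset.map_singleton,
    Multiset.prod_cons, Multiset.prod_singleton, map_neg]
  ring

/-- A polynomial with factored derivative `6 (x + a₁) (x + a₂) (x + a₃) (x - b₁) (x - b₂)` agrees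
with a `sexticPrimitive`. -/
lemma exists_eval_eq_sexticPrimitive {P : ℝ[X]} {a₁ a₂ a₃ b₁ b₂ : ℝ}
    (h : derivative P =
      C 6 * ((X + C a₁) * (X + C a₂) * (X + C a₃) * (X - C b₁) * (X - C b₂))) :
    ∃ k, ∀ x, P.eval x = sexticPrimitive a₁ a₂ a₃ b₁ b₂ k x := by
  refine ⟨P.eval 0, fun x => ?_⟩
  have hderiv : ∀ y, HasDerivAt
      (fun y => P.eval y - sexticPrimitive a₁ a₂ a₃ b₁ b₂ (P.eval 0) y) 0 y := by
    intro y
    have := (P.hasDerivAt y).sub (hasDerivAt_sexticPrimitive a₁ a₂ a₃ b₁ b₂ (P.eval 0) y)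
    refine this.congr_deriv ?_
    rw [h]
    simp
  have hconst := is_const_of_deriv_eq_zero (fun y => (hderiv y).differentiableAt)
    (fun y => (hderiv y).deriv) x 0
  have hzero : sexticPrimitive a₁ a₂ a₃ b₁ b₂ (P.eval 0) 0 = P.eval 0 := by
    simp [sexticPrimitive]
  simp only [hzero, sub_self] at hconst
  linarith

/-- The sequence of compatible pairs `((0,2),(2,3),(1,3),(1,2),(1,1),(1,0))`
is not realizable in degree 6. -/
theorem stmt_0 :
    ¬ ∃ P : Polynomial ℝ, P.Monic ∧ P.natDegree = 6 ∧
      (∀ i ≤ 6, P.coeff i ≠ 0) ∧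
      (∀ k ≤ 5, ∀ x : ℝ, (derivative^[k] P).rootMultiplicity x ≤ 1) ∧
      posRoots P = 0 ∧ negRoots P = 2 ∧
      posRoots (derivative^[1] P) = 2 ∧ negRoots (derivative^[1] P) = 3 ∧
      posRoots (derivative^[2] P) = 1 ∧ negRoots (derivative^[2] P) = 3 ∧
      posRoots (derivative^[3] P) = 1 ∧ negRoots (derivative^[3] P) = 2 ∧
      posRoots (derivative^[4] P) = 1 ∧ negRoots (derivative^[4] P) = 1 ∧
      posRoots (derivative^[5] P) = 1 ∧ negRoots (derivative^[5] P) = 0 := by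
  rintro ⟨P, hmonic, hdeg, -, -, hp₀, hn₀, hp₁, hn₁, hp₂, hn₂, -, -, -, -, hp₅, -⟩
  simp only [Function.iterate_succ, Function.iterate_zero, Function.comp_apply, id_eq]
    at hp₁ hn₁ hp₂ hn₂ hp₅
  have hdeg₁ : (derivative P).natDegree = 5 := by rw [natDegree_derivative, hdeg]
  have hlead₁ : (derivative P).leadingCoeff = 6 := by
    rw [leadingCoeff_derivative, hmonic.leadingCoeff, hdeg]
    norm_num
  have hdeg₂ : (derivative (derivative P)).natDegree = 4 := by rw [natDegree_derivative, hdeg₁]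
  have hlead₂ : (derivative (derivative P)).leadingCoeff = 30 := by
    rw [leadingCoeff_derivative, hlead₁, hdeg₁]
    norm_num
  obtain ⟨a₁, a₂, a₃, b₁, b₂, ha₁, h₁₂, h₂₃, hb₁, hb, hP⟩ :=
    exists_eq_quintic_prod hdeg₁ hp₁ hn₁
  rw [hlead₁] at hP
  have hinv : b₁ * b₂ * (a₁ * a₂ + a₁ * a₃ + a₂ * a₃) < (b₁ + b₂) * (a₁ * a₂ * a₃) := by
    have hneg := eval_zero_neg_of_posRoots_eq_one (by rw [hlead₂]; norm_num) hdeg₂ hp₂ hn₂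
    rw [hP] at hneg
    simp at hneg
    linarith
  have hsum : a₁ + a₂ + a₃ < b₁ + b₂ := by
    obtain ⟨x, hx, hx0⟩ := exists_pos_root_of_posRoots_ne_zero (hp₅.trans_ne one_ne_zero)
    rw [hP] at hx0
    simp at hx0
    linarith
  obtain ⟨k, hk⟩ := exists_eval_eq_sexticPrimitive hP
  have hpos : ∀ x, 0 < x → 0 < sexticPrimitive a₁ a₂ a₃ b₁ b₂ k x := fun x hx => by
    rw [← hk]
    refine eval_pos_of_posRoots_eq_zero ?_ ?_ hp₀ hx
    · rw [hmonic.leadingCoeff]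
      exact one_pos
    · exact natDegree_pos_iff_degree_pos.1 (by omega)
  obtain ⟨x, hx, hx0⟩ := exists_neg_root_of_negRoots_ne_zero (hn₀.trans_ne two_ne_zero)
  have := sexticPrimitive_pos_of_neg ha₁ h₁₂ h₂₃ hb₁ hb hsum hinv hpos hx
  rw [← hk, hx0] at this
  exact lt_irrefl _ this
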